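/- Let π_LPL(n) denote the number of LPL-primes not exceeding n and π(n) the number of primes not exceeding n. Then liminf_{n→∞} π_LPL(n)/π(n) ≥ 1/2. -/

import Mathlib

/-- `nthPrime n` is the n-th prime with 1-based indexing: p_1 = 2, p_2 = 3, ... -/
noncomputable def nthPrime (n : ℕ) : ℕ := Nat.nth Nat.Prime (n - 1)

/-- An LPL-prime: either 2 or 3, or an odd prime p = p_n with n ≥ 3 satisfying
Condition 3, i.e. every integer k with (p_{n-1}+1)/2 ≤ k ≤ (p−1)/2 is composite. -/
def IsLPL (p : ℕ) : Prop :=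
  p = 2 ∨ p = 3 ∨ (p.Prime ∧ Odd p ∧ ∀ n : ℕ, 3 ≤ n → p = nthPrime n →
    ∀ k : ℕ, (nthPrime (n - 1) + 1) / 2 ≤ k → k ≤ (p - 1) / 2 → ¬ k.Prime)

/-- π_LPL(n): the number of LPL-primes not exceeding n. -/
noncomputable def countLPL (n : ℕ) : ℕ :=
  letI := Classical.decPred IsLPL
  ((Finset.range (n + 1)).filter IsLPL).card

open Filter Topology

open MeasureTheory Set Complex in
theorem tendsto_integral_smoothed_eq_zero {r : ℝ → ℝ} (hr : Measurable r) {M : ℝ}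
    (hM : ∀ u, |r u| ≤ M) (hr0 : ∀ u ≤ 0, r u = 0) {G : ℂ → ℂ}
    (hG : ContinuousOn G {z | 0 ≤ z.re})
    (hrG : ∀ z : ℂ, 0 < z.re → ∫ u : ℝ, r u * exp (-z * u) = G z)
    {K : ℝ → ℝ} (hK : Integrable K) {w : ℝ → ℂ} (hw : Continuous w)
    (hKw : ∀ x : ℝ, (K x : ℂ) = ∫ t in Ioc (-1 : ℝ) 1, w t * exp (I * x * t)) :
    Tendsto (fun y : ℝ ↦ ∫ x : ℝ, r (y - x) * K x) atTop (𝓝 0) := by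
  have hM0 : 0 ≤ M := (abs_nonneg _).trans (hM 0)
  -- integrability of the damped function
  have hint : ∀ σ : ℝ, 0 < σ → Integrable (fun u : ℝ ↦ (r u * Real.exp (-σ * u) : ℂ)) := by
    intro σ hσ
    have hdom : Integrable ((Ioi (0 : ℝ)).indicator fun u ↦ M * Real.exp (-σ * u)) :=
      (integrable_indicator_iff measurableSet_Ioi).2
        ((integrableOn_exp_mul_Ioi (neg_lt_zero.2 hσ) 0).const_mul M)
    refine hdom.mono' (by fun_prop) (Eventually.of_forall fun u ↦ ?_)
    rcases le_or_gt u 0 with hu | hu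
    · simp [hr0 u hu, hu]
    · rw [indicator_of_mem (mem_Ioi.2 hu), ← ofReal_mul, norm_real, Real.norm_eq_abs, abs_mul,
        Real.abs_exp]
      gcongr
      exact hM u
  have hwint : IntegrableOn w (Ioc (-1 : ℝ) 1) :=
    (hw.integrableOn_Icc (a := -1) (b := 1)).mono_set Ioc_subset_Icc_self
  -- the identity for the damped function
  have hid : ∀ (σ y : ℝ), 0 < σ →
      ∫ x : ℝ, ((r (y - x) * Real.exp (-σ * (y - x)) * K x : ℝ) : ℂ) =
        ∫ t in Ioc (-1 : ℝ) 1, w t * exp (I * y * t) * G (σ + I * t) := by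
    intro σ y hσ
    have h1 : ∀ x : ℝ, ((r (y - x) * Real.exp (-σ * (y - x)) * K x : ℝ) : ℂ) =
        ∫ t in Ioc (-1 : ℝ) 1,
          (r (y - x) * Real.exp (-σ * (y - x) : ℝ)) * w t * exp (I * x * t) := by
      intro x
      simp_rw [mul_assoc _ (w _)]
      rw [integral_const_mul, ← hKw]
      push_cast
      ring
    simp_rw [h1]
    rw [integral_integral_swap]
    · refine setIntegral_congr_fun measurableSet_Ioc fun t _ ↦ ?_
      have h2 := integral_sub_left_eq_self
        (fun u : ℝ ↦ (r u * Real.exp (-σ * u : ℝ)) * w t * exp (I * (y - u) * t)) volume y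
      rw [← hrG (σ + I * t) (by simpa using hσ), ← integral_const_mul]
      convert h2 using 1
      · congr 1 with x
        push_cast
        ring_nf
      · congr 1 with u
        have : exp (I * (y - u) * t) = exp (I * y * t) * exp (-(I * t) * u) := by
          rw [← exp_add]; ring_nf
        have h3 : exp (-(σ + I * t) * u) = exp (-σ * u) * exp (-(I * t) * u) := by
          rw [← exp_add]; ring_nf
        rw [this, h3]
        push_cast
        ring
    · have h3 : Integrable (fun x : ℝ ↦ (r (y - x) * Real.exp (-σ * (y - x) : ℝ) : ℂ)) :=
        (hint σ hσ).comp_sub_left y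
      have h4 := (h3.mul_prod hwint)
      refine h4.mono (by fun_prop) (Eventually.of_forall fun p ↦ ?_)
      simp only [Function.uncurry, norm_mul]
      rw [show I * p.1 * p.2 = ((p.1 * p.2 : ℝ) : ℂ) * I by push_cast; ring, norm_exp_ofReal_mul_I,
        mul_one]
  -- passage to the boundary
  have hbdry : ∀ y : ℝ, ((∫ x : ℝ, r (y - x) * K x : ℝ) : ℂ) =
      ∫ t in Ioc (-1 : ℝ) 1, w t * exp (I * y * t) * G (I * t) := by
    intro y
    have hl : Tendsto (fun σ : ℝ ↦ ∫ x : ℝ, ((r (y - x) * Real.exp (-σ * (y - x)) * K x : ℝ) : ℂ))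
        (𝓝[>] 0) (𝓝 (∫ x : ℝ, ((r (y - x) * K x : ℝ) : ℂ))) := by
      refine tendsto_integral_filter_of_dominated_convergence (fun x ↦ M * |K x|) ?_ ?_
        (hK.abs.const_mul M) ?_
      · refine Eventually.of_forall fun σ ↦ ?_
        have := hK.aestronglyMeasurable
        fun_prop
      · filter_upwards [self_mem_nhdsWithin] with σ hσ
        refine Eventually.of_forall fun x ↦ ?_
        rw [norm_real, Real.norm_eq_abs, abs_mul, abs_mul, Real.abs_exp]
        gcongr
        rcases le_or_gt (y - x) 0 with hu | hu
        · simp [hr0 _ hu, hM0]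
        · have h5 : Real.exp (-σ * (y - x)) ≤ 1 :=
            Real.exp_le_one_iff.2 (by nlinarith [mem_Ioi.1 hσ])
          calc |r (y - x)| * Real.exp (-σ * (y - x)) ≤ M * 1 := by
                gcongr
                exact hM _
            _ = M := mul_one M
      · refine Eventually.of_forall fun x ↦ ?_
        have : Continuous fun σ : ℝ ↦ ((r (y - x) * Real.exp (-σ * (y - x)) * K x : ℝ) : ℂ) := by
          fun_prop
        have h6 := (this.tendsto 0).mono_left (nhdsWithin_le_nhds (s := Ioi 0))
        simpa using h6
    have hr' : Tendsto (fun σ : ℝ ↦ ∫ t in Ioc (-1 : ℝ) 1, w t * exp (I * y * t) * G (σ + I * t))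
        (𝓝[>] 0) (𝓝 (∫ t in Ioc (-1 : ℝ) 1, w t * exp (I * y * t) * G (I * t))) := by
      have hmaps : ∀ p ∈ Icc (0 : ℝ) 1 ×ˢ Icc (-1 : ℝ) 1,
          (p.1 + I * p.2 : ℂ) ∈ {z : ℂ | 0 ≤ z.re} := fun p hp ↦ by simpa using hp.1.1
      have hcont : ContinuousOn (fun p : ℝ × ℝ ↦ G (p.1 + I * p.2)) (Icc (0 : ℝ) 1 ×ˢ Icc (-1) 1) :=
        hG.comp (by fun_prop) hmaps
      obtain ⟨C, hC⟩ := (isCompact_Icc.prod isCompact_Icc).exists_bound_of_continuousOn hcont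
      have hσ1 : ∀ᶠ σ : ℝ in 𝓝[>] 0, σ ∈ Ioo (0 : ℝ) 1 := Ioo_mem_nhdsGT one_pos
      refine tendsto_integral_filter_of_dominated_convergence (fun t ↦ ‖w t‖ * C) ?_ ?_
        (hwint.norm.mul_const C) ?_
      · filter_upwards [hσ1] with σ hσ
        refine ContinuousOn.aestronglyMeasurable ?_ measurableSet_Ioc
        refine ContinuousOn.mul (by fun_prop) (hG.comp (by fun_prop) fun t _ ↦ ?_)
        simpa using hσ.1.le
      · filter_upwards [hσ1] with σ hσ
        refine (ae_restrict_iff' measurableSet_Ioc).2 (Eventually.of_forall fun t ht ↦ ?_)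
        rw [norm_mul, norm_mul, show I * y * t = ((y * t : ℝ) : ℂ) * I by push_cast; ring,
          norm_exp_ofReal_mul_I, mul_one]
        gcongr
        exact hC (σ, t) ⟨Ioo_subset_Icc_self hσ, Ioc_subset_Icc_self ht⟩
      · refine Eventually.of_forall fun t ↦ Tendsto.const_mul _ ?_
        have h7 : Tendsto (fun σ : ℝ ↦ (σ + I * t : ℂ)) (𝓝[>] 0) (𝓝[{z | 0 ≤ z.re}] (I * t)) := by
          refine tendsto_nhdsWithin_iff.2 ⟨?_, ?_⟩
          · have : Continuous fun σ : ℝ ↦ (σ + I * t : ℂ) := by fun_prop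
            simpa using (this.tendsto 0).mono_left (nhdsWithin_le_nhds (s := Ioi 0))
          · filter_upwards [self_mem_nhdsWithin] with σ hσ
            simpa using (mem_Ioi.1 hσ).le
        exact (hG (I * t) (by simp)).tendsto.comp h7
    rw [← integral_complex_ofReal]
    refine tendsto_nhds_unique hl (hr'.congr' ?_)
    filter_upwards [self_mem_nhdsWithin] with σ hσ
    exact (hid σ y hσ).symm
  -- the Riemann-Lebesgue lemma
  have hRL := Real.tendsto_integral_exp_smul_cocompact
    ((Ioc (-1 : ℝ) 1).indicator fun t : ℝ ↦ w t * G (I * t))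
  have hscale : Tendsto (fun y : ℝ ↦ -(2 * Real.pi)⁻¹ * y) atTop (cocompact ℝ) :=
    (tendsto_id.const_mul_atTop_of_neg (by have := Real.pi_pos; simpa using this)).mono_right
      atBot_le_cocompact
  have h8 := hRL.comp hscale
  rw [← ofReal_zero] at h8
  have h9 : Tendsto (fun y : ℝ ↦ ((∫ x : ℝ, r (y - x) * K x : ℝ) : ℂ)) atTop (𝓝 (0 : ℝ)) := by
    refine h8.congr fun y ↦ ?_
    rw [hbdry, ← integral_indicator measurableSet_Ioc]
    simp only [Function.comp]
    congr 1 with t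
    by_cases ht : t ∈ Ioc (-1 : ℝ) 1
    · rw [indicator_of_mem ht, indicator_of_mem ht, Circle.smul_def, Real.fourierChar_apply,
        smul_eq_mul]
      have : ((2 * Real.pi * -(t * (-(2 * Real.pi)⁻¹ * y)) : ℝ) : ℂ) * I = I * y * t := by
        rw [show (2 * Real.pi * -(t * (-(2 * Real.pi)⁻¹ * y)) : ℝ) = t * y by
          field_simp [Real.pi_ne_zero]]
        push_cast
        ring
      rw [this]
      ring
    · rw [indicator_of_notMem ht, indicator_of_notMem ht, smul_zero]
  exact tendsto_ofReal_iff.1 h9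

open MeasureTheory Set Complex in
lemma sinc_half_sq_eq_integral (x : ℝ) :
    ((Real.sinc (x / 2) ^ 2 : ℝ) : ℂ) =
      ∫ t in Ioc (-1 : ℝ) 1, ((1 - |t| : ℝ) : ℂ) * exp (I * x * t) := by
  rw [← intervalIntegral.integral_of_le (by norm_num)]
  have hcont : Continuous fun t : ℝ ↦ ((1 - |t| : ℝ) : ℂ) * exp (I * x * t) := by fun_prop
  rw [← intervalIntegral.integral_add_adjacent_intervals (b := 0) (hcont.intervalIntegrable _ _)
    (hcont.intervalIntegrable _ _)]
  have hneg : ∫ t in (-1 : ℝ)..0, ((1 - |t| : ℝ) : ℂ) * exp (I * x * t) =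
      ∫ t in (-1 : ℝ)..0, (1 + t) * exp (I * x * t) := by
    refine intervalIntegral.integral_congr fun t ht ↦ ?_
    rw [uIcc_of_le (by norm_num)] at ht
    simp [abs_of_nonpos ht.2]
  have hpos : ∫ t in (0 : ℝ)..1, ((1 - |t| : ℝ) : ℂ) * exp (I * x * t) =
      ∫ t in (0 : ℝ)..1, (1 - t) * exp (I * x * t) := by
    refine intervalIntegral.integral_congr fun t ht ↦ ?_
    rw [uIcc_of_le (by norm_num)] at ht
    simp [abs_of_nonneg ht.1]
  rw [hneg, hpos]
  rcases eq_or_ne x 0 with rfl | hx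
  · have h1 : ∫ t in (-1 : ℝ)..0, ((1 : ℂ) + t) = 1 / 2 := by
      have : ∫ t in (-1 : ℝ)..0, (1 + t) = 1 / 2 := by
        rw [intervalIntegral.integral_add (by simp) (by simp)]
        norm_num
      have h := congrArg ((↑) : ℝ → ℂ) this
      rw [← intervalIntegral.integral_ofReal] at h
      simpa using h
    have h2 : ∫ t in (0 : ℝ)..1, ((1 : ℂ) - t) = 1 / 2 := by
      have : ∫ t in (0 : ℝ)..1, (1 - t) = 1 / 2 := by
        rw [intervalIntegral.integral_sub (by simp) (by simp)]
        norm_num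
      have h := congrArg ((↑) : ℝ → ℂ) this
      rw [← intervalIntegral.integral_ofReal] at h
      simpa using h
    simp [h1, h2]
    norm_num
  · have hxC : (x : ℂ) ≠ 0 := ofReal_ne_zero.2 hx
    set c : ℂ := I * x with hc
    have hc0 : c ≠ 0 := mul_ne_zero I_ne_zero hxC
    have hexp : ∀ t : ℝ, HasDerivAt (fun t : ℝ ↦ exp (c * t)) (exp (c * t) * c) t := fun t ↦ by
      simpa using ((hasDerivAt_id (t : ℂ)).const_mul c).cexp.comp_ofReal
    have hid : ∀ t : ℝ, HasDerivAt (fun t : ℝ ↦ (t : ℂ)) 1 t := fun t ↦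
      (hasDerivAt_id (t : ℂ)).comp_ofReal
    have h1 : ∫ t in (-1 : ℝ)..0, (1 + t) * exp (c * t) = 1 / c - 1 / c ^ 2 + exp (-c) / c ^ 2 := by
      rw [intervalIntegral.integral_eq_sub_of_hasDerivAt
        (f := fun t : ℝ ↦ (1 + t) * exp (c * t) / c - exp (c * t) / c ^ 2)]
      · simp
      · intro t _
        convert! ((((hid t).const_add 1).mul (hexp t)).div_const c).sub
          ((hexp t).div_const (c ^ 2)) using 1
        field_simp
        ring
      · exact Continuous.intervalIntegrable (by fun_prop) _ _
    have h2 : ∫ t in (0 : ℝ)..1, (1 - t) * exp (c * t) = exp c / c ^ 2 - 1 / c - 1 / c ^ 2 := by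
      rw [intervalIntegral.integral_eq_sub_of_hasDerivAt
        (f := fun t : ℝ ↦ (1 - t) * exp (c * t) / c + exp (c * t) / c ^ 2)]
      · simp
        ring
      · intro t _
        convert! ((((hid t).const_sub 1).mul (hexp t)).div_const c).add
          ((hexp t).div_const (c ^ 2)) using 1
        field_simp
        ring
      · exact Continuous.intervalIntegrable (by fun_prop) _ _
    rw [h1, h2, Real.sinc_of_ne_zero (by simpa using hx)]
    have hcos : exp c + exp (-c) = 2 * cos x := by
      rw [hc, two_cos, mul_comm I, neg_mul]
    have hsin : (2 : ℂ) - 2 * cos x = 4 * sin (x / 2) ^ 2 := by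
      have h3 := cos_sq (x / 2 : ℂ)
      have h4 := sin_sq_add_cos_sq (x / 2 : ℂ)
      rw [mul_div_cancel₀ _ two_ne_zero] at h3
      linear_combination (-4) * h4 + 4 * h3
    have hcsq : c ^ 2 = -x ^ 2 := by rw [hc, mul_pow, I_sq]; ring
    have : 1 / c - 1 / c ^ 2 + exp (-c) / c ^ 2 + (exp c / c ^ 2 - 1 / c - 1 / c ^ 2) =
        (2 - 2 * cos x) / x ^ 2 := by
      rw [← hcos, hcsq]
      field_simp
      ring
    rw [this, hsin]
    push_cast
    field_simp
    ring

open MeasureTheory in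
lemma integrable_sinc_half_sq : Integrable fun x : ℝ ↦ Real.sinc (x / 2) ^ 2 := by
  refine (integrable_inv_one_add_sq.const_mul 5).mono'
    (by fun_prop) (Eventually.of_forall fun x ↦ ?_)
  rw [Real.norm_eq_abs, abs_of_nonneg (sq_nonneg _), ← div_eq_mul_inv, le_div_iff₀ (by positivity)]
  have h1 : Real.sinc (x / 2) ^ 2 ≤ 1 := by
    rw [sq_le_one_iff_abs_le_one]; exact Real.abs_sinc_le_one _
  have h2 : Real.sinc (x / 2) ^ 2 * x ^ 2 ≤ 4 := by
    rcases eq_or_ne x 0 with rfl | hx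
    · simp
    · rw [Real.sinc_of_ne_zero (by simpa using hx)]
      have := Real.sin_sq_le_one (x / 2)
      field_simp
      linarith
  linarith

open MeasureTheory in
lemma integral_sinc_half_sq_pos : 0 < ∫ x : ℝ, Real.sinc (x / 2) ^ 2 := by
  refine integral_pos_of_integrable_nonneg_nonzero (x := 0) (by fun_prop)
    integrable_sinc_half_sq (fun x ↦ sq_nonneg _) ?_
  simp

open MeasureTheory Set Complex in
theorem tendsto_integral_mul_fejer_eq_zero {r : ℝ → ℝ} (hr : Measurable r) {M : ℝ}
    (hM : ∀ u, |r u| ≤ M) (hr0 : ∀ u ≤ 0, r u = 0) {G : ℂ → ℂ}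
    (hG : ContinuousOn G {z | 0 ≤ z.re})
    (hrG : ∀ z : ℂ, 0 < z.re → ∫ u : ℝ, r u * exp (-z * u) = G z) {l : ℝ} (hl : 0 < l) :
    Tendsto (fun y : ℝ ↦ ∫ x : ℝ, r (y - x / l) * Real.sinc (x / 2) ^ 2) atTop (𝓝 0) := by
  have h := tendsto_integral_smoothed_eq_zero (r := fun u ↦ r (u / l)) (by fun_prop)
    (fun u ↦ hM _) (fun u hu ↦ hr0 _ (div_nonpos_of_nonpos_of_nonneg hu hl.le))
    (G := fun z ↦ l * G (l * z))
    (continuousOn_const.mul (hG.comp (by fun_prop) fun z hz ↦ by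
      simpa using mul_nonneg hl.le hz)) (fun z hz ↦ ?_) integrable_sinc_half_sq
    (w := fun t ↦ ((1 - |t| : ℝ) : ℂ)) (by fun_prop) sinc_half_sq_eq_integral
  · refine (h.comp (tendsto_id.const_mul_atTop hl)).congr fun y ↦ ?_
    simp only [Function.comp, id, sub_div, mul_div_cancel_left₀ _ hl.ne']
  · have h1 := Measure.integral_comp_div (fun u : ℝ ↦ (r u : ℂ) * exp (-(l * z) * u)) l
    rw [hrG (l * z) (by simpa using mul_pos hl hz), abs_of_pos hl] at h1
    rw [← real_smul, ← h1]
    congr 1 with u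
    congr 2
    have : (l : ℂ) ≠ 0 := ofReal_ne_zero.2 hl.ne'
    push_cast
    field_simp

open MeasureTheory Set in
lemma tendsto_integral_mul_fejer {H : ℝ → ℝ} (hH : Measurable H) {M : ℝ} (hH0 : ∀ u, 0 ≤ H u)
    (hHM : ∀ u, H u ≤ M) (hneg : ∀ u ≤ 0, H u = 0) {G : ℂ → ℂ}
    (hG : ContinuousOn G {z | 0 ≤ z.re})
    (hHG : ∀ z : ℂ, 0 < z.re →
      ∫ u : ℝ, ((H u - (Ioi 0).indicator 1 u : ℝ) : ℂ) * Complex.exp (-z * u) = G z)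
    {l : ℝ} (hl : 0 < l) :
    Tendsto (fun y : ℝ ↦ ∫ x : ℝ, H (y - x / l) * Real.sinc (x / 2) ^ 2) atTop
      (𝓝 (∫ x : ℝ, Real.sinc (x / 2) ^ 2)) := by
  have hind : Measurable ((Ioi (0 : ℝ)).indicator (1 : ℝ → ℝ)) :=
    measurable_one.indicator measurableSet_Ioi
  have hind1 : ∀ u : ℝ, |(Ioi (0 : ℝ)).indicator (1 : ℝ → ℝ) u| ≤ 1 := fun u ↦ by
    by_cases hu : u ∈ Ioi (0 : ℝ) <;> simp [hu]
  have hr : ∀ u, |H u - (Ioi (0 : ℝ)).indicator (1 : ℝ → ℝ) u| ≤ M + 1 := fun u ↦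
    (abs_sub _ _).trans (add_le_add (by rw [abs_of_nonneg (hH0 u)]; exact hHM u) (hind1 u))
  have h1 := tendsto_integral_mul_fejer_eq_zero (hH.sub hind) hr
    (fun u hu ↦ by simp [hneg u hu, hu]) hG hHG hl
  have h2 : Tendsto
      (fun y : ℝ ↦ ∫ x : ℝ, (Ioi (0 : ℝ)).indicator 1 (y - x / l) * Real.sinc (x / 2) ^ 2)
      atTop (𝓝 (∫ x : ℝ, Real.sinc (x / 2) ^ 2)) := by
    refine tendsto_integral_filter_of_dominated_convergence _ (Eventually.of_forall fun y ↦ ?_)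
      (Eventually.of_forall fun y ↦ Eventually.of_forall fun x ↦ ?_) integrable_sinc_half_sq
      (Eventually.of_forall fun x ↦ ?_)
    · exact ((hind.comp (by fun_prop)).mul (by fun_prop)).aestronglyMeasurable
    · rw [norm_mul, Real.norm_eq_abs, Real.norm_eq_abs, abs_of_nonneg (sq_nonneg (Real.sinc _))]
      exact mul_le_of_le_one_left (sq_nonneg _) (hind1 _)
    · refine tendsto_const_nhds.congr' ?_
      filter_upwards [eventually_gt_atTop (x / l)] with y hy
      rw [indicator_of_mem (mem_Ioi.2 (sub_pos.2 hy)), Pi.one_apply, one_mul]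
  have h3 := h1.add h2
  rw [zero_add] at h3
  refine h3.congr fun y ↦ ?_
  rw [← integral_add]
  · congr 1 with x
    simp only [Pi.sub_apply]
    ring
  · exact integrable_sinc_half_sq.bdd_mul (c := M + 1)
      ((hH.sub hind).comp (by fun_prop)).aestronglyMeasurable (Eventually.of_forall fun x ↦ hr _)
  · exact integrable_sinc_half_sq.bdd_mul (c := 1)
      (hind.comp (by fun_prop)).aestronglyMeasurable (Eventually.of_forall fun x ↦ hind1 _)

open MeasureTheory Set in
/-- A Tauberian theorem of Wiener-Ikehara type. -/
theorem tendsto_one_of_laplace {H : ℝ → ℝ} (hH : Measurable H) {M : ℝ} (hH0 : ∀ u, 0 ≤ H u)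
    (hHM : ∀ u, H u ≤ M) (hneg : ∀ u ≤ 0, H u = 0)
    (hmono : ∀ u v, u ≤ v → H u ≤ H v * Real.exp (v - u)) {G : ℂ → ℂ}
    (hG : ContinuousOn G {z | 0 ≤ z.re})
    (hHG : ∀ z : ℂ, 0 < z.re →
      ∫ u : ℝ, ((H u - (Ioi 0).indicator 1 u : ℝ) : ℂ) * Complex.exp (-z * u) = G z) :
    Tendsto H atTop (𝓝 1) := by
  set K : ℝ → ℝ := fun x ↦ Real.sinc (x / 2) ^ 2 with hKdef
  have hK0 : ∀ x, 0 ≤ K x := fun x ↦ sq_nonneg _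
  have hKint : Integrable K := integrable_sinc_half_sq
  set κ : ℝ := ∫ x, K x with hκ
  have hκ0 : 0 < κ := integral_sinc_half_sq_pos
  have hJ : ∀ l : ℝ, 0 < l → Tendsto (fun y : ℝ ↦ ∫ x : ℝ, H (y - x / l) * K x) atTop (𝓝 κ) :=
    fun l hl ↦ tendsto_integral_mul_fejer hH hH0 hHM hneg hG hHG hl
  have hHK : ∀ l y : ℝ, Integrable fun x ↦ H (y - x / l) * K x := fun l y ↦
    hKint.bdd_mul (c := M) (hH.comp (by fun_prop)).aestronglyMeasurable
      (Eventually.of_forall fun x ↦ by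
        rw [Real.norm_eq_abs, abs_of_nonneg (hH0 _)]; exact hHM _)
  set κ' : ℝ → ℝ := fun A ↦ ∫ x in Ioc (-A) A, K x with hκ'
  have hκlim : Tendsto κ' atTop (𝓝 κ) := by
    refine (intervalIntegral_tendsto_integral hKint tendsto_neg_atTop_atBot tendsto_id).congr' ?_
    filter_upwards [eventually_ge_atTop 0] with A hA
    exact intervalIntegral.integral_of_le (by simp only [id]; linarith)
  have hκle : ∀ A, κ' A ≤ κ := fun A ↦
    setIntegral_le_integral hKint (Eventually.of_forall hK0)
  have hexp : Tendsto (fun δ : ℝ ↦ Real.exp (2 * δ)) (𝓝[>] 0) (𝓝 1) := by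
    have : Continuous fun δ : ℝ ↦ Real.exp (2 * δ) := by fun_prop
    simpa using (this.tendsto 0).mono_left (nhdsWithin_le_nhds (s := Ioi 0))
  have hwin : ∀ {A δ x : ℝ}, 0 < A → 0 < δ → x ∈ Ioc (-A) A → |x / (A / δ)| ≤ δ := by
    intro A δ x hA hδ hx
    rw [abs_div, abs_of_pos (div_pos hA hδ), div_le_iff₀ (div_pos hA hδ), mul_div_cancel₀ _ hδ.ne']
    exact abs_le.2 ⟨hx.1.le, hx.2⟩
  have hupper : ∀ {A δ : ℝ}, 0 < A → 0 < δ → ∀ y,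
      H y * κ' A ≤ Real.exp (2 * δ) * ∫ x : ℝ, H (y + δ - x / (A / δ)) * K x := by
    intro A δ hA hδ y
    calc H y * κ' A = ∫ x in Ioc (-A) A, H y * K x := (integral_const_mul _ _).symm
      _ ≤ ∫ x in Ioc (-A) A, Real.exp (2 * δ) * (H (y + δ - x / (A / δ)) * K x) := by
        refine setIntegral_mono_on (hKint.const_mul _).integrableOn
          ((hHK _ _).const_mul _).integrableOn measurableSet_Ioc fun x hx ↦ ?_
        have hx' := abs_le.1 (hwin hA hδ hx)
        rw [← mul_assoc]
        refine mul_le_mul_of_nonneg_right ?_ (hK0 x)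
        refine (hmono y (y + δ - x / (A / δ)) (by linarith)).trans ?_
        rw [mul_comm]
        refine mul_le_mul_of_nonneg_right (Real.exp_le_exp.2 (by linarith)) (hH0 _)
      _ = Real.exp (2 * δ) * ∫ x in Ioc (-A) A, H (y + δ - x / (A / δ)) * K x :=
        integral_const_mul _ _
      _ ≤ _ := by
        refine mul_le_mul_of_nonneg_left ?_ (Real.exp_pos _).le
        exact setIntegral_le_integral (hHK _ _)
          (Eventually.of_forall fun x ↦ mul_nonneg (hH0 _) (hK0 x))
  have hlower : ∀ {A δ : ℝ}, 0 < A → 0 < δ → ∀ y,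
      ∫ x : ℝ, H (y - δ - x / (A / δ)) * K x ≤
        H y * Real.exp (2 * δ) * κ + M * (κ - κ' A) := by
    intro A δ hA hδ y
    rw [← integral_add_compl (measurableSet_Ioc (a := -A) (b := A)) (hHK _ _)]
    have hcompl : ∫ x in (Ioc (-A) A)ᶜ, K x = κ - κ' A := by
      rw [hκ, ← integral_add_compl (measurableSet_Ioc (a := -A) (b := A)) hKint]
      ring
    rw [← hcompl]
    refine add_le_add ?_ ?_
    · calc ∫ x in Ioc (-A) A, H (y - δ - x / (A / δ)) * K x
          ≤ ∫ x in Ioc (-A) A, H y * Real.exp (2 * δ) * K x := by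
            refine setIntegral_mono_on (hHK _ _).integrableOn
              (hKint.const_mul _).integrableOn measurableSet_Ioc fun x hx ↦ ?_
            have hx' := abs_le.1 (hwin hA hδ hx)
            refine mul_le_mul_of_nonneg_right ?_ (hK0 x)
            refine (hmono (y - δ - x / (A / δ)) y (by linarith)).trans ?_
            exact mul_le_mul_of_nonneg_left (Real.exp_le_exp.2 (by linarith)) (hH0 _)
        _ = H y * Real.exp (2 * δ) * κ' A := integral_const_mul _ _
        _ ≤ _ := mul_le_mul_of_nonneg_left (hκle A) (mul_nonneg (hH0 _) (Real.exp_pos _).le)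
    · rw [← integral_const_mul]
      refine setIntegral_mono_on (hHK _ _).integrableOn
        (hKint.const_mul _).integrableOn measurableSet_Ioc.compl fun x hx ↦ ?_
      exact mul_le_mul_of_nonneg_right (hHM _) (hK0 x)
  refine tendsto_order.2 ⟨fun a ha ↦ ?_, fun a ha ↦ ?_⟩
  · obtain ⟨δ, hδ1, hδ⟩ := (((hexp.const_mul a).eventually_lt_const
      (show a * 1 < 1 by linarith)).and self_mem_nhdsWithin).exists
    have hlim : Tendsto (fun A ↦ a * Real.exp (2 * δ) * κ + M * (κ - κ' A)) atTop
        (𝓝 (a * Real.exp (2 * δ) * κ + M * (κ - κ))) :=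
      ((hκlim.const_sub κ).const_mul M).const_add _
    obtain ⟨A, hA1, hA⟩ := ((hlim.eventually_lt_const
      (show _ < κ by rw [sub_self, mul_zero, add_zero]; nlinarith)).and
      (eventually_gt_atTop 0)).exists
    have hev := ((hJ (A / δ) (div_pos hA hδ)).comp
      (tendsto_atTop_add_const_right atTop (-δ) tendsto_id)).eventually_const_lt hA1
    filter_upwards [hev] with y hy
    have h1 := hlower hA hδ y
    simp only [Function.comp, id, ← sub_eq_add_neg] at hy
    have h2 : a * (Real.exp (2 * δ) * κ) < H y * (Real.exp (2 * δ) * κ) := by linarith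
    exact lt_of_mul_lt_mul_right h2 (by positivity)
  · obtain ⟨A, hA1, hA2, hA⟩ := (((hκlim.const_mul a).eventually_const_lt
      (show κ < a * κ by nlinarith)).and ((hκlim.eventually_const_lt hκ0).and
      (eventually_gt_atTop 0))).exists
    obtain ⟨δ, hδ1, hδ⟩ := (((hexp.mul_const κ).eventually_lt_const
      (show 1 * κ < a * κ' A by linarith)).and self_mem_nhdsWithin).exists
    have hev := (((hJ (A / δ) (div_pos hA hδ)).comp
      (tendsto_atTop_add_const_right atTop δ tendsto_id)).const_mul
      (Real.exp (2 * δ))).eventually_lt_const hδ1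
    filter_upwards [hev] with y hy
    exact lt_of_mul_lt_mul_right ((hupper hA hδ y).trans_lt hy) hA2.le

open ArithmeticFunction in
lemma residueClass_one_eq_vonMangoldt :
    vonMangoldt.residueClass (1 : ZMod 1) = fun n ↦ vonMangoldt n := by
  ext n
  exact Set.indicator_of_mem (s := {n : ℕ | (n : ZMod 1) = 1}) (Subsingleton.elim (n : ZMod 1) 1)
    (fun n ↦ vonMangoldt n)

open MeasureTheory Set Complex in
lemma LSeries_vonMangoldt_eq_laplace {z : ℂ} (hz : 0 < z.re) :
    LSeries (fun n ↦ (ArithmeticFunction.vonMangoldt n : ℂ)) (1 + z) =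
      (1 + z) * ∫ u in Ioi (0 : ℝ),
        ((Chebyshev.psi (Real.exp u) * Real.exp (-u) : ℝ) : ℂ) * exp (-z * u) := by
  have hsum : ∀ n : ℕ, ∑ k ∈ Finset.Icc 1 n, ArithmeticFunction.vonMangoldt k =
      Chebyshev.psi n := fun n ↦ by
    rw [Chebyshev.psi, Nat.floor_natCast]
    rfl
  rw [LSeries_eq_mul_integral_of_nonneg _ zero_le_one (by simpa using hz) ?_
    fun n ↦ ArithmeticFunction.vonMangoldt_nonneg]
  · congr 1
    have himg : Real.exp '' Ioi 0 = Ioi 1 := by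
      ext x
      refine ⟨?_, fun hx ↦ ⟨Real.log x, Real.log_pos hx, Real.exp_log (one_pos.trans hx)⟩⟩
      rintro ⟨u, hu, rfl⟩
      exact Real.one_lt_exp_iff.2 hu
    rw [← himg, integral_image_eq_integral_abs_deriv_smul measurableSet_Ioi
      (fun u _ ↦ (Real.hasDerivAt_exp u).hasDerivWithinAt) Real.exp_injective.injOn]
    congr 1 with u
    rw [← ofReal_sum, hsum, ← Chebyshev.psi_eq_psi_coe_floor, Real.abs_exp, real_smul,
      cpow_def_of_ne_zero (ofReal_ne_zero.2 (Real.exp_pos u).ne'), ← ofReal_log (Real.exp_pos u).le,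
      Real.log_exp, ofReal_mul, ofReal_exp, ofReal_exp,
      show (u : ℂ) * -(1 + z + 1) = -u + (-u + -z * u) by ring, exp_add, exp_add, ofReal_neg,
      exp_neg]
    have := exp_ne_zero (u : ℂ)
    field_simp
  · refine Asymptotics.IsBigO.of_bound (Real.log 4 + 4) (Eventually.of_forall fun n ↦ ?_)
    rw [hsum, Real.norm_eq_abs, abs_of_nonneg (Chebyshev.psi_nonneg _), Real.rpow_one,
      Real.norm_natCast]
    exact Chebyshev.psi_le_const_mul_self (Nat.cast_nonneg n)

open MeasureTheory Set Complex ArithmeticFunction in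
/-- The Prime Number Theorem for the Chebyshev function `ψ`. -/
theorem tendsto_psi_div : Tendsto (fun x : ℝ ↦ Chebyshev.psi x / x) atTop (𝓝 1) := by
  set H : ℝ → ℝ := fun u ↦ Chebyshev.psi (Real.exp u) * Real.exp (-u) with hH
  have hmeas : Measurable H :=
    (Chebyshev.psi_mono.measurable.comp Real.measurable_exp).mul (by fun_prop)
  have hH0 : ∀ u, 0 ≤ H u := fun u ↦ mul_nonneg (Chebyshev.psi_nonneg _) (Real.exp_pos _).le
  have hHM : ∀ u, H u ≤ Real.log 4 + 4 := fun u ↦ by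
    simp only [hH, Real.exp_neg]
    exact (mul_inv_le_iff₀ (Real.exp_pos u)).2
      (Chebyshev.psi_le_const_mul_self (Real.exp_pos u).le)
  have hneg : ∀ u ≤ 0, H u = 0 := fun u hu ↦ by
    simp only [hH]
    rw [Chebyshev.psi_eq_zero_of_le_one (Real.exp_le_one_iff.2 hu), zero_mul]
  have hmono : ∀ u v, u ≤ v → H u ≤ H v * Real.exp (v - u) := fun u v huv ↦ by
    simp only [hH]
    rw [mul_assoc, ← Real.exp_add, show -v + (v - u) = -u by ring]
    gcongr
  set F := vonMangoldt.LFunctionResidueClassAux (1 : ZMod 1)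
  have hlim : Tendsto H atTop (𝓝 1) := by
    refine tendsto_one_of_laplace hmeas hH0 hHM hneg hmono
      (G := fun z ↦ (F (1 + z) - 1) / (1 + z)) ?_ fun z hz ↦ ?_
    · refine ContinuousOn.div ?_ (by fun_prop) fun z hz h0 ↦ ?_
      · refine ContinuousOn.sub ?_ continuousOn_const
        exact (vonMangoldt.continuousOn_LFunctionResidueClassAux (1 : ZMod 1)).comp
          (by fun_prop) fun z hz ↦ by simpa using hz
      · have := congrArg re h0
        have hz' : 0 ≤ z.re := hz
        simp only [add_re, one_re, zero_re] at this
        linarith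
    · have hz0 : z ≠ 0 := fun h ↦ by simp [h] at hz
      have hz1 : 1 + z ≠ 0 := fun h ↦ by
        have := congrArg re h
        simp only [add_re, one_re, zero_re] at this
        linarith
      have hF : F (1 + z) = (1 + z) * (∫ u in Ioi (0 : ℝ), (H u : ℂ) * exp (-z * u)) - 1 / z := by
        have h1 := vonMangoldt.eqOn_LFunctionResidueClassAux (isUnit_one (M := ZMod 1))
          (show 1 + z ∈ {s : ℂ | 1 < s.re} by simpa using hz)
        simp only [residueClass_one_eq_vonMangoldt, LSeries_vonMangoldt_eq_laplace hz] at h1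
        simpa [F, hH] using h1
      have hexp : IntegrableOn (fun u : ℝ ↦ exp (-z * u)) (Ioi 0) :=
        integrableOn_exp_mul_complex_Ioi (by simpa using hz) 0
      have hHexp : IntegrableOn (fun u : ℝ ↦ (H u : ℂ) * exp (-z * u)) (Ioi 0) :=
        hexp.bdd_mul (c := Real.log 4 + 4) (by fun_prop) (Eventually.of_forall fun u ↦ by
          rw [norm_real, Real.norm_eq_abs, abs_of_nonneg (hH0 u)]; exact hHM u)
      have hind : (fun u : ℝ ↦ ((H u - (Ioi 0).indicator 1 u : ℝ) : ℂ) * exp (-z * u)) =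
          (Ioi 0).indicator fun u : ℝ ↦ (H u : ℂ) * exp (-z * u) - exp (-z * u) := by
        ext u
        by_cases hu : u ∈ Ioi (0 : ℝ)
        · simp only [indicator_of_mem hu, Pi.one_apply, ofReal_sub, ofReal_one]
          ring
        · simp [indicator_of_notMem hu, hneg u (not_lt.1 hu)]
      rw [hind, integral_indicator measurableSet_Ioi, integral_sub hHexp hexp,
        integral_exp_mul_complex_Ioi (by simpa using hz), hF]
      simp only [ofReal_zero, mul_zero, Complex.exp_zero]
      field_simp
      ring
  refine (hlim.comp Real.tendsto_log_atTop).congr' ?_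
  filter_upwards [eventually_gt_atTop 0] with x hx
  simp only [Function.comp, hH]
  rw [Real.exp_neg, Real.exp_log hx, div_eq_mul_inv]

lemma IsLPL.prime {p : ℕ} (h : IsLPL p) : p.Prime := by
  rcases h with rfl | rfl | h
  · exact Nat.prime_two
  · exact Nat.prime_three
  · exact h.1

lemma primeCounting_eq_card_filter (n : ℕ) :
    Nat.primeCounting n = ((Finset.range (n + 1)).filter Nat.Prime).card := by
  rw [Nat.primeCounting, Nat.primeCounting', Nat.count_eq_card_filter_range]

lemma primeCounting_pos_of_two_le {n : ℕ} (hn : 2 ≤ n) : 0 < Nat.primeCounting n := by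
  rw [primeCounting_eq_card_filter]
  exact Finset.card_pos.2 ⟨2, by simp [Nat.prime_two]; omega⟩

lemma countLPL_le_primeCounting (n : ℕ) : countLPL n ≤ Nat.primeCounting n := by
  classical
  rw [primeCounting_eq_card_filter, countLPL]
  exact Finset.card_le_card fun p hp ↦ by
    rw [Finset.mem_filter] at hp ⊢
    exact ⟨hp.1, hp.2.prime⟩

lemma exists_prime_between_of_not_isLPL (p : ℕ) (hp : p.Prime) (h : ¬ IsLPL p) :
    Odd p ∧ ∃ k : ℕ, k.Prime ∧ k ≤ (p - 1) / 2 ∧ ∀ q : ℕ, q.Prime → q < p → (q + 1) / 2 ≤ k := by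
  have hodd : Odd p := hp.odd_of_ne_two fun h2 ↦ h (.inl h2)
  refine ⟨hodd, ?_⟩
  by_contra! hcon
  refine h (.inr (.inr ⟨hp, hodd, fun n hn hpn k hk hkp hkprime ↦ ?_⟩))
  obtain ⟨q, hq, hqp, hkq⟩ := hcon k hkprime hkp
  have hqle : q ≤ nthPrime (n - 1) := by
    obtain ⟨j, -, rfl⟩ := Nat.exists_lt_card_nth_eq hq
    rw [hpn, nthPrime, Nat.nth_lt_nth Nat.infinite_setOfPred_prime] at hqp
    rw [nthPrime, Nat.nth_le_nth Nat.infinite_setOfPred_prime]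
    omega
  omega

lemma primeCounting_le_countLPL_add (n : ℕ) :
    Nat.primeCounting n ≤ countLPL n + Nat.primeCounting (n / 2) := by
  classical
  have hsplit : Nat.primeCounting n ≤
      countLPL n + ((Finset.range (n + 1)).filter fun p ↦ p.Prime ∧ ¬ IsLPL p).card := by
    rw [primeCounting_eq_card_filter, countLPL]
    refine (Finset.card_le_card fun p hp ↦ ?_).trans (Finset.card_union_le _ _)
    simp only [Finset.mem_union, Finset.mem_filter] at hp ⊢
    tauto
  refine hsplit.trans (Nat.add_le_add_left ?_ _)
  choose! hodd k hkprime hkle hkge using exists_prime_between_of_not_isLPL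
  rw [primeCounting_eq_card_filter]
  refine Finset.card_le_card_of_injOn k (fun p hp ↦ ?_) fun p hp q hq hpq ↦ ?_
  · simp only [Finset.coe_filter, Finset.mem_range, Set.mem_ofPred_eq] at hp ⊢
    have := hkle p hp.2.1 hp.2.2
    exact ⟨by omega, hkprime p hp.2.1 hp.2.2⟩
  · simp only [Finset.coe_filter, Finset.mem_range, Set.mem_ofPred_eq] at hp hq
    have key : ∀ {a b : ℕ}, a.Prime → ¬ IsLPL a → b.Prime → ¬ IsLPL b → k a = k b →
        ¬ a < b := fun {a b} ha ha' hb hb' hab hlt ↦ by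
      have h1 := hkge b hb hb' a ha hlt
      have h2 := hkle a ha ha'
      have h3 := ha.two_le
      obtain ⟨c, rfl⟩ := hodd a ha ha'
      omega
    exact le_antisymm (not_lt.1 (key hq.2.1 hq.2.2 hp.2.1 hp.2.2 hpq.symm))
      (not_lt.1 (key hp.2.1 hp.2.2 hq.2.1 hq.2.2 hpq))

open Chebyshev in
theorem tendsto_primeCounting_mul_log_div
    (h : Tendsto (fun x : ℝ ↦ psi x / x) atTop (𝓝 1)) :
    Tendsto (fun x : ℝ ↦ (Nat.primeCounting ⌊x⌋₊ : ℝ) * Real.log x / x) atTop (𝓝 1) := by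
  have h1 : Tendsto (fun x : ℝ ↦ (psi x - theta x) / x) atTop (𝓝 0) := by
    refine (isBigO_psi_sub_theta_sqrt.trans_isLittleO ?_).tendsto_div_nhds_zero
    refine (Asymptotics.isLittleO_iff_tendsto' ?_).2 ?_
    · filter_upwards [eventually_gt_atTop 0] with x hx h0
      exact absurd h0 hx.ne'
    · refine (tendsto_inv_atTop_zero.comp Real.tendsto_sqrt_atTop).congr' ?_
      filter_upwards [eventually_gt_atTop 0] with x hx
      rw [Function.comp, Real.sqrt_div_self', one_div]
  have h2 := integral_theta_div_log_sq_isLittleO.tendsto_div_nhds_zero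
  have h3 := (h.sub h1).add h2
  rw [sub_zero, add_zero] at h3
  refine h3.congr' ?_
  filter_upwards [eventually_gt_atTop 2] with x hx
  rw [primeCounting_eq_theta_div_log_add_integral hx.le]
  have : Real.log x ≠ 0 := (Real.log_pos (by linarith)).ne'
  have : x ≠ 0 := by linarith
  field_simp
  ring

theorem tendsto_primeCounting_half_div
    (h : Tendsto (fun x : ℝ ↦ (Nat.primeCounting ⌊x⌋₊ : ℝ) * Real.log x / x) atTop (𝓝 1)) :
    Tendsto (fun n : ℕ ↦ (Nat.primeCounting (n / 2) : ℝ) / Nat.primeCounting n) atTop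
      (𝓝 (1 / 2)) := by
  have hhalf : Tendsto (fun x : ℝ ↦ x / 2) atTop atTop := tendsto_id.atTop_div_const two_pos
  have hlog : Tendsto (fun x : ℝ ↦ Real.log x / Real.log (x / 2)) atTop (𝓝 1) := by
    have h0 : Tendsto (fun x : ℝ ↦ 1 + Real.log 2 / Real.log (x / 2)) atTop (𝓝 (1 + 0)) :=
      (tendsto_const_nhds.div_atTop (Real.tendsto_log_atTop.comp hhalf)).const_add 1
    rw [add_zero] at h0
    refine h0.congr' ?_
    filter_upwards [eventually_gt_atTop 2] with x hx
    have hpos : Real.log (x / 2) ≠ 0 := (Real.log_pos (by linarith)).ne'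
    rw [Real.log_div (by linarith) two_ne_zero] at hpos ⊢
    field_simp
    ring
  have h1 := (((h.comp hhalf).div h one_ne_zero).mul hlog).div_const 2
  have h2 := h1.comp tendsto_natCast_atTop_atTop
  rw [div_one, one_mul] at h2
  refine h2.congr' ?_
  filter_upwards [eventually_gt_atTop 2] with n hn
  have hn' : (2 : ℝ) < n := by exact_mod_cast hn
  have hpi : (Nat.primeCounting n : ℝ) ≠ 0 := by
    have : 0 < Nat.primeCounting n := primeCounting_pos_of_two_le hn.le
    positivity
  have hfl : ⌊(n : ℝ) / 2⌋₊ = n / 2 := by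
    exact_mod_cast Nat.floor_div_natCast (n : ℝ) 2 |>.trans (by simp)
  simp only [Function.comp, Nat.floor_natCast, Pi.div_apply, hfl]
  have : Real.log n ≠ 0 := (Real.log_pos (by linarith)).ne'
  have : Real.log (n / 2) ≠ 0 := (Real.log_pos (by linarith)).ne'
  field_simp



/-- liminf_{n→∞} π_LPL(n)/π(n) ≥ 1/2. -/
theorem liminf_LPL_ge_half :
    (1 : ℝ) / 2 ≤
      Filter.liminf (fun n : ℕ => (countLPL n : ℝ) / (Nat.primeCounting n : ℝ))
        Filter.atTop := by
  have h := (tendsto_primeCounting_half_div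
    (tendsto_primeCounting_mul_log_div tendsto_psi_div)).const_sub 1
  rw [show (1 : ℝ) / 2 = 1 - 1 / 2 by norm_num, ← h.liminf_eq]
  refine liminf_le_liminf ?_ h.isBoundedUnder_ge ?_
  · filter_upwards [eventually_ge_atTop 2] with n hn
    have hpi : (0 : ℝ) < Nat.primeCounting n := by
      exact_mod_cast primeCounting_pos_of_two_le hn
    have hle : (Nat.primeCounting n : ℝ) ≤ countLPL n + Nat.primeCounting (n / 2) := by
      exact_mod_cast primeCounting_le_countLPL_add n
    rw [one_sub_div hpi.ne']
    gcongr
    linarith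
  · refine IsBoundedUnder.isCoboundedUnder_ge ⟨1, ?_⟩
    refine eventually_map.2 (Eventually.of_forall fun n ↦ ?_)
    exact div_le_one_of_le₀ (by exact_mod_cast countLPL_le_primeCounting n) (Nat.cast_nonneg _)
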